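/- Let A₁, A₂, A₃, A₄ and A₊ be five affine parabolic spaces in 𝔰𝔩ₙ(ℝ) that are pairwise transverse (A₊ playing the role of the auxiliary space A_*). Then the cocycle identity β(A₁,A_*,A₃,A₄) + β(A_*,A₂,A₃,A₄) = β(A₁,A₂,A₃,A₄) holds. -/

import Mathlib

open Matrix

noncomputable section

abbrev Mn (n : ℕ) := Matrix (Fin n) (Fin n) ℝ

/-- Conjugation `Z ↦ g Z g⁻¹` as a linear map on matrices. -/
def AdM {n : ℕ} (g : Mn n) : Mn n →ₗ[ℝ] Mn n where
  toFun Z := g * Z * g⁻¹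
  map_add' X Y := by simp [Matrix.add_mul, Matrix.mul_add]
  map_smul' c X := by simp [Matrix.smul_mul, Matrix.mul_smul]

/-- Projection onto the diagonal part. -/
def pi0 {n : ℕ} : Mn n →ₗ[ℝ] Mn n where
  toFun Z := Matrix.diagonal (fun i => Z i i)
  map_add' X Y := by
    ext i j
    by_cases h : i = j <;> simp [Matrix.diagonal_apply, h]
  map_smul' c X := by
    ext i j
    by_cases h : i = j <;> simp [Matrix.diagonal_apply, h]

/-- The involution reversing the diagonal entries (on diagonal matrices). -/
def omega0 {n : ℕ} : Mn n →ₗ[ℝ] Mn n where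
  toFun Z := Matrix.diagonal (fun i => Z i.rev i.rev)
  map_add' X Y := by
    ext i j
    by_cases h : i = j <;> simp [Matrix.diagonal_apply, h]
  map_smul' c X := by
    ext i j
    by_cases h : i = j <;> simp [Matrix.diagonal_apply, h]

/-- Traceless matrices: 𝔰𝔩ₙ(ℝ). -/
def slSub (n : ℕ) : Submodule ℝ (Mn n) := LinearMap.ker (Matrix.traceLinearMap (Fin n) ℝ ℝ)

/-- Matrices vanishing below the diagonal (upper triangular). -/
def upTri (n : ℕ) : Submodule ℝ (Mn n) where
  carrier := {Z | ∀ i j : Fin n, j < i → Z i j = 0}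
  add_mem' := by intro a b ha hb i j h; simp [Matrix.add_apply, ha i j h, hb i j h]
  zero_mem' := by intro i j h; rfl
  smul_mem' := by intro c a ha i j h; simp [Matrix.smul_apply, ha i j h]

/-- Matrices vanishing above the diagonal (lower triangular). -/
def loTri (n : ℕ) : Submodule ℝ (Mn n) where
  carrier := {Z | ∀ i j : Fin n, i < j → Z i j = 0}
  add_mem' := by intro a b ha hb i j h; simp [Matrix.add_apply, ha i j h, hb i j h]
  zero_mem' := by intro i j h; rfl
  smul_mem' := by intro c a ha i j h; simp [Matrix.smul_apply, ha i j h]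

/-- Diagonal matrices. -/
def diagSub (n : ℕ) : Submodule ℝ (Mn n) where
  carrier := {Z | ∀ i j : Fin n, i ≠ j → Z i j = 0}
  add_mem' := by intro a b ha hb i j h; simp [Matrix.add_apply, ha i j h, hb i j h]
  zero_mem' := by intro i j h; rfl
  smul_mem' := by intro c a ha i j h; simp [Matrix.smul_apply, ha i j h]

/-- Strictly upper triangular matrices: 𝔫⁺. -/
def nplus (n : ℕ) : Submodule ℝ (Mn n) where
  carrier := {Z | ∀ i j : Fin n, j ≤ i → Z i j = 0}
  add_mem' := by intro a b ha hb i j h; simp [Matrix.add_apply, ha i j h, hb i j h]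
  zero_mem' := by intro i j h; rfl
  smul_mem' := by intro c a ha i j h; simp [Matrix.smul_apply, ha i j h]

/-- Strictly lower triangular matrices: 𝔫⁻. -/
def nminus (n : ℕ) : Submodule ℝ (Mn n) where
  carrier := {Z | ∀ i j : Fin n, i ≤ j → Z i j = 0}
  add_mem' := by intro a b ha hb i j h; simp [Matrix.add_apply, ha i j h, hb i j h]
  zero_mem' := by intro i j h; rfl
  smul_mem' := by intro c a ha i j h; simp [Matrix.smul_apply, ha i j h]

/-- 𝔟⁺ : traceless upper triangular matrices. -/
def bplus (n : ℕ) : Submodule ℝ (Mn n) := slSub n ⊓ upTri n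

/-- 𝔟⁻ : traceless lower triangular matrices. -/
def bminus (n : ℕ) : Submodule ℝ (Mn n) := slSub n ⊓ loTri n

/-- 𝔞 : traceless diagonal matrices. -/
def aSub (n : ℕ) : Submodule ℝ (Mn n) := slSub n ⊓ diagSub n

/-- A parabolic subspace of 𝔰𝔩ₙ(ℝ): a subspace of the form Ad(g)𝔟⁺ with g ∈ SLₙ(ℝ). -/
def IsParabolic {n : ℕ} (V : Submodule ℝ (Mn n)) : Prop :=
  ∃ g : Mn n, g.det = 1 ∧ V = (bplus n).map (AdM g)

/-- Two subspaces are transverse if together they span 𝔰𝔩ₙ(ℝ). -/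
def Transv {n : ℕ} (V W : Submodule ℝ (Mn n)) : Prop := V ⊔ W = slSub n

/-- A standardizer of an ordered transverse pair of parabolic subspaces. -/
def IsStd {n : ℕ} (h : Mn n) (V₁ V₂ : Submodule ℝ (Mn n)) : Prop :=
  h.det = 1 ∧ (bplus n).map (AdM h) = V₁ ∧ (bminus n).map (AdM h) = V₂

/-- ν*_{i,j} computed with the standardizer h. -/
def nustar {n : ℕ} (h : Mn n) : Mn n →ₗ[ℝ] Mn n := pi0 ∘ₗ AdM h⁻¹

/-- ν_{i,j} computed with the standardizer h. -/
def nuMap {n : ℕ} (h : Mn n) : Mn n →ₗ[ℝ] Mn n := AdM h ∘ₗ pi0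

/-- π_{i,j} computed with the standardizer h. -/
def piStd {n : ℕ} (h : Mn n) : Mn n →ₗ[ℝ] Mn n := AdM h ∘ₗ pi0 ∘ₗ AdM h⁻¹

/-- The commutator subspace [V,V]. -/
def commSub {n : ℕ} (V : Submodule ℝ (Mn n)) : Submodule ℝ (Mn n) :=
  Submodule.span ℝ {z | ∃ x ∈ V, ∃ y ∈ V, z = x * y - y * x}

/-- An affine parabolic space with direction V: an affine subspace X + V of 𝔰𝔩ₙ(ℝ)
whose direction V is a parabolic subspace. -/
def IsAffPara {n : ℕ} (A : Set (Mn n)) (V : Submodule ℝ (Mn n)) : Prop :=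
  IsParabolic V ∧ ∃ X : Mn n, X ∈ slSub n ∧ A = {Z | Z - X ∈ V}

/-- `IsCross b A₁ A₂ A₃ A₄ V₁ V₂ V₃ V₄` : b is a value of the affine cross ratio
β(A₁,A₂,A₃,A₄), computed with some choice of standardizers and intersection points. -/
def IsCross {n : ℕ} (b : Mn n) (A₁ A₂ A₃ A₄ : Set (Mn n))
    (V₁ V₂ V₃ V₄ : Submodule ℝ (Mn n)) : Prop :=
  ∃ h₁₄ h₂₃ : Mn n, ∃ X₁₃ X₂₄ : Mn n,
    IsStd h₁₄ V₁ V₄ ∧ IsStd h₂₃ V₂ V₃ ∧ X₁₃ ∈ A₁ ∩ A₃ ∧ X₂₄ ∈ A₂ ∩ A₄ ∧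
    b = nustar h₁₄ (X₁₃ - X₂₄) - nustar h₂₃ (X₁₃ - X₂₄)

/-- `IsTriple d A₂ A₃ A₄ V₂ V₃ V₄` : d is a value of the affine triple ratio
δ(A₂,A₃,A₄), computed with some choice of standardizers and points. -/
def IsTriple {n : ℕ} (d : Mn n) (A₂ A₃ A₄ : Set (Mn n))
    (V₂ V₃ V₄ : Submodule ℝ (Mn n)) : Prop :=
  ∃ h₂₃ h₃₂ h₃₄ h₄₃ h₄₂ h₂₄ : Mn n, ∃ X₂ X₃ X₄ : Mn n,
    IsStd h₂₃ V₂ V₃ ∧ IsStd h₃₂ V₃ V₂ ∧ IsStd h₃₄ V₃ V₄ ∧ IsStd h₄₃ V₄ V₃ ∧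
    IsStd h₄₂ V₄ V₂ ∧ IsStd h₂₄ V₂ V₄ ∧ X₂ ∈ A₂ ∧ X₃ ∈ A₃ ∧ X₄ ∈ A₄ ∧
    d = (nustar h₂₃ (X₂ - X₃) + nustar h₃₂ (X₂ - X₃))
      + (nustar h₃₄ (X₃ - X₄) + nustar h₄₃ (X₃ - X₄))
      + (nustar h₄₂ (X₄ - X₂) + nustar h₂₄ (X₄ - X₂))

/-- The affine action of (g,Y) ∈ SLₙ(ℝ) ⋉ 𝔰𝔩ₙ(ℝ) on 𝔰𝔩ₙ(ℝ). -/
def affMap {n : ℕ} (g Y : Mn n) : Mn n → Mn n := fun Z => g * Z * g⁻¹ + Y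

section Corner

variable {n : ℕ}

lemma AdM_apply (g Z : Mn n) : AdM g Z = g * Z * g⁻¹ := rfl

lemma AdM_inv_AdM {g : Mn n} (hg : IsUnit g.det) (Z : Mn n) : AdM g⁻¹ (AdM g Z) = Z := by
  simp only [AdM_apply, nonsing_inv_nonsing_inv g hg]
  simp only [Matrix.mul_assoc, nonsing_inv_mul g hg, Matrix.mul_one]
  rw [← Matrix.mul_assoc, nonsing_inv_mul g hg, Matrix.one_mul]

lemma nustar_AdM {g : Mn n} (hg : IsUnit g.det) (Z : Mn n) :
    nustar g (AdM g Z) = pi0 Z := by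
  simp [nustar, AdM_inv_AdM hg]

/-- The coordinate projection onto the indices in `S`. -/
def coordProj (S : Set (Fin n)) : Mn n :=
  open Classical in diagonal fun i => if i ∈ S then 1 else 0

lemma coordProj_mul_self (S : Set (Fin n)) : coordProj S * coordProj S = coordProj S := by
  simp [coordProj, diagonal_mul_diagonal]

lemma coordProj_mul_upTri {S : Set (Fin n)} (hS : IsUpperSet S) {x : Mn n} (hx : x ∈ upTri n) :
    coordProj S * x * coordProj S = coordProj S * x := by
  ext i j
  simp only [coordProj, mul_diagonal, diagonal_mul]
  by_cases hi : i ∈ S <;> by_cases hj : j ∈ S <;> simp only [hi, hj, if_true, if_false] <;> try simp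
  have hji : j < i := lt_of_not_ge fun hij => hj (hS hij hi)
  exact (hx i j hji).symm

lemma coordProj_mul_loTri {S : Set (Fin n)} (hS : IsUpperSet S) {y : Mn n} (hy : y ∈ loTri n) :
    coordProj S * y * coordProj S = y * coordProj S := by
  ext i j
  simp only [coordProj, mul_diagonal, diagonal_mul]
  by_cases hi : i ∈ S <;> by_cases hj : j ∈ S <;> simp only [hi, hj, if_true, if_false] <;> try simp
  have hij : i < j := lt_of_not_ge fun hji => hi (hS hji hj)
  exact (hy i j hij).symm

lemma trace_coordProj_mul (S : Set (Fin n)) (x : Mn n) :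
    (coordProj S * x).trace = open Classical in ∑ i, if i ∈ S then x i i else 0 := by
  simp [coordProj, Matrix.trace, diagonal_mul]

/-- The corner of `a` cut out by an upper set of indices is invertible as soon as
`upTri + a loTri a⁻¹` contains all traceless matrices. -/
lemma det_corner_ne_zero {S : Set (Fin n)} (hS : IsUpperSet S) {a : Mn n} (ha : IsUnit a.det)
    (hspan : ∀ Z : Mn n, Z.trace = 0 → ∃ x ∈ upTri n, ∃ y ∈ loTri n, Z = x + a * y * a⁻¹) :
    (coordProj S * a * coordProj S + (1 - coordProj S)).det ≠ 0 := by
  set p := coordProj S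
  have hpp : p * p = p := coordProj_mul_self S
  intro hdet
  obtain ⟨w, hw0, hw⟩ := exists_mulVec_eq_zero_iff.2 hdet
  obtain ⟨f, hf0, hf⟩ := exists_vecMul_eq_zero_iff.2 hdet
  have hpw : p *ᵥ w = w := by
    have h := congrArg (fun u => (1 - p) *ᵥ u) hw
    simp only [mulVec_mulVec, mulVec_zero] at h
    have e : (1 - p) * (p * a * p + (1 - p)) = 1 - p := by
      linear_combination (norm := noncomm_ring) -hpp * (a * p) + hpp
    rw [e, sub_mulVec, one_mulVec, sub_eq_zero] at h
    exact h.symm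
  have hpf : f ᵥ* p = f := by
    have h := congrArg (fun u => u ᵥ* (1 - p)) hf
    simp only [vecMul_vecMul, zero_vecMul] at h
    have e : (p * a * p + (1 - p)) * (1 - p) = 1 - p := by
      linear_combination (norm := noncomm_ring) -(p * a) * hpp + hpp
    rw [e, vecMul_sub, vecMul_one, sub_eq_zero] at h
    exact h.symm
  have hpv : p *ᵥ (a *ᵥ w) = 0 := by
    rw [add_mulVec, sub_mulVec, one_mulVec, hpw, sub_self, add_zero, ← mulVec_mulVec, hpw,
      ← mulVec_mulVec] at hw
    exact hw
  have hfa : (f ᵥ* a) ᵥ* p = 0 := by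
    rw [vecMul_add, vecMul_sub, vecMul_one, hpf, sub_self, add_zero, ← vecMul_vecMul,
      ← vecMul_vecMul, hpf] at hf
    exact hf
  set v := a *ᵥ w with hv
  have hwv : a⁻¹ *ᵥ v = w := by rw [hv, mulVec_mulVec, nonsing_inv_mul a ha, one_mulVec]
  have hv0 : v ≠ 0 := fun h => hw0 (by rw [← hwv, h, mulVec_zero])
  have hfv : f ⬝ᵥ v = 0 := by
    rw [← hpf, ← dotProduct_mulVec, hpv, dotProduct_zero]
  have hn : (n : ℝ) ≠ 0 := by
    rintro h
    obtain rfl : n = 0 := by exact_mod_cast h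
    exact hv0 (Subsingleton.elim _ _)
  obtain ⟨x, hx, y, hy, hZ⟩ := hspan
    (vecMulVec f v - ((vecMulVec f v).trace / n) • (1 : Mn n)) (by
      rw [trace_sub, trace_smul, trace_one, Fintype.card_fin, smul_eq_mul, div_mul_cancel₀ _ hn,
        sub_self])
  have key := congrArg (fun Z => f ⬝ᵥ (Z *ᵥ v)) hZ
  have hx' : f ⬝ᵥ (x *ᵥ v) = 0 := by
    rw [← hpf, ← dotProduct_mulVec, mulVec_mulVec, ← coordProj_mul_upTri hS hx, ← mulVec_mulVec,
      hpv, mulVec_zero, dotProduct_zero]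
  have hy' : f ⬝ᵥ ((a * y * a⁻¹) *ᵥ v) = 0 := by
    rw [← mulVec_mulVec, hwv, ← hpw, ← mulVec_mulVec, mulVec_mulVec _ y,
      ← coordProj_mul_loTri hS hy, dotProduct_mulVec, dotProduct_mulVec, ← vecMul_vecMul,
      ← vecMul_vecMul, hfa]
    simp
  simp only [add_mulVec, dotProduct_add, hx', hy', sub_mulVec, smul_mulVec, one_mulVec,
    dotProduct_sub, dotProduct_smul, hfv, smul_zero, sub_zero, add_zero] at key
  rw [vecMulVec_mulVec] at key
  simp only [op_smul_eq_smul, dotProduct_smul, smul_eq_mul, mul_eq_zero,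
    dotProduct_self_eq_zero] at key
  exact key.elim hv0 hf0

lemma pi0_eq_of_mul_eq {a x y : Mn n} (ha : IsUnit a.det)
    (hspan : ∀ Z : Mn n, Z.trace = 0 → ∃ x ∈ upTri n, ∃ y ∈ loTri n, Z = x + a * y * a⁻¹)
    (hx : x ∈ upTri n) (hy : y ∈ loTri n) (h : x * a = a * y) : pi0 x = pi0 y := by
  have htr : ∀ S : Set (Fin n), IsUpperSet S →
      (coordProj S * x).trace = (coordProj S * y).trace := by
    intro S hS
    have hN := (isUnit_iff_ne_zero.2 (det_corner_ne_zero hS ha hspan))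
    have hpx := coordProj_mul_upTri hS hx
    have hpy := coordProj_mul_loTri hS hy
    have hpp := coordProj_mul_self S
    set p := coordProj S
    set N := p * a * p + (1 - p) with hNdef
    have hcomm : (p * x) * N = N * (y * p) := by
      have e₁ : (p * x) * N = p * (x * a) * p := by
        rw [← hpx, hNdef]
        linear_combination (norm := noncomm_ring)
          p * x * hpp * a * p - p * x * hpp + hpx * a * p
      have e₂ : N * (y * p) = p * (a * y) * p := by
        rw [← hpy, hNdef]
        linear_combination (norm := noncomm_ring)
          p * a * hpp * y * p - hpp * y * p + p * a * hpy
      rw [e₁, e₂, h]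
    have hconj : p * x = N * (y * p) * N⁻¹ := by
      rw [← hcomm, Matrix.mul_assoc, mul_nonsing_inv N hN, Matrix.mul_one]
    rw [hconj, trace_mul_comm, ← Matrix.mul_assoc, nonsing_inv_mul N hN, Matrix.one_mul,
      trace_mul_comm]
  have hdiag : ∀ k, x k k = y k k := by
    intro k
    have split : ∀ z : Mn n, (coordProj (Set.Ici k) * z).trace =
        z k k + (coordProj (Set.Ioi k) * z).trace := by
      classical
      intro z
      rw [trace_coordProj_mul, trace_coordProj_mul,
        ← (Finset.sum_ite_eq' Finset.univ k fun i => z i i).trans (if_pos (Finset.mem_univ k)),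
        ← Finset.sum_add_distrib]
      refine Finset.sum_congr rfl fun i _ => ?_
      rcases lt_trichotomy i k with hi | rfl | hi
      · simp [hi.ne, hi.not_ge, hi.not_gt]
      · simp
      · simp [hi.ne', hi.le, hi]
    have h₁ := htr _ (isUpperSet_Ici k)
    rw [split, split, htr _ (isUpperSet_Ioi k)] at h₁
    exact add_right_cancel h₁
  simp [pi0, hdiag]

end Corner

section Nustar

variable {n : ℕ}

/-- If `Ad(g)𝔟⁺` and `Ad(h)𝔟⁻` are transverse, then the diagonal projections read
through `g` and through `h` agree on their intersection. -/
lemma nustar_eq_of_mem_inter {g h : Mn n} (hg : IsUnit g.det) (hh : IsUnit h.det)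
    (ht : Transv ((bplus n).map (AdM g)) ((bminus n).map (AdM h))) {d : Mn n}
    (hd₁ : d ∈ (bplus n).map (AdM g)) (hd₂ : d ∈ (bminus n).map (AdM h)) :
    nustar g d = nustar h d := by
  obtain ⟨x, hx, rfl⟩ := hd₁
  obtain ⟨y, hy, hxy⟩ := hd₂
  rw [← hxy, nustar_AdM hh, hxy, nustar_AdM hg]
  have hgi : g⁻¹ * g = 1 := nonsing_inv_mul g hg
  have hhi : h⁻¹ * h = 1 := nonsing_inv_mul h hh
  have ha : IsUnit (g⁻¹ * h).det := by
    rw [det_mul]; exact (isUnit_nonsing_inv_det g hg).mul hh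
  have hainv : (g⁻¹ * h)⁻¹ = h⁻¹ * g := by
    rw [Matrix.mul_inv_rev, nonsing_inv_nonsing_inv g hg]
  refine pi0_eq_of_mul_eq ha ?_ hx.2 hy.2 ?_
  · intro Z hZ
    have hmem : AdM g Z ∈ slSub n := by
      rw [slSub, LinearMap.mem_ker, traceLinearMap_apply, AdM_apply, trace_mul_comm,
        ← Matrix.mul_assoc, hgi, Matrix.one_mul, hZ]
    rw [← ht, Submodule.mem_sup] at hmem
    obtain ⟨_, ⟨x', hx', rfl⟩, _, ⟨y', hy', rfl⟩, hsum⟩ := hmem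
    refine ⟨x', hx'.2, y', hy'.2, ?_⟩
    have := congrArg (AdM g⁻¹) hsum
    rw [map_add, AdM_inv_AdM hg, AdM_inv_AdM hg] at this
    rw [← this, hainv]
    simp only [AdM_apply, nonsing_inv_nonsing_inv g hg, Matrix.mul_assoc]
  · simp only [AdM_apply] at hxy
    calc x * (g⁻¹ * h) = g⁻¹ * (g * x * g⁻¹) * h := by
          linear_combination (norm := noncomm_ring) -hgi * x * g⁻¹ * h
      _ = g⁻¹ * (h * y * h⁻¹) * h := by rw [hxy]
      _ = g⁻¹ * h * y := by
          linear_combination (norm := noncomm_ring) g⁻¹ * h * y * hhi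

lemma transpose_mem_upTri {x : Mn n} (hx : x ∈ loTri n) : xᵀ ∈ upTri n :=
  fun i j hij => hx j i hij

lemma upTri_pow_diag {x : Mn n} (hx : x ∈ upTri n) (k : ℕ) :
    x ^ k ∈ upTri n ∧ ∀ i, (x ^ k) i i = x i i ^ k := by
  induction k with
  | zero => exact ⟨fun i j hij => by simp [hij.ne'], by simp⟩
  | succ k ih =>
    refine ⟨?_, fun i => ?_⟩
    · rw [pow_succ]
      exact BlockTriangular.mul (b := id) ih.1 hx
    · rw [pow_succ, mul_apply, Finset.sum_eq_single i, ih.2, pow_succ]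
      · intro j _ hj
        rcases lt_or_gt_of_ne hj with hlt | hlt
        · rw [ih.1 i j hlt, zero_mul]
        · rw [hx j i hlt, mul_zero]
      · simp

lemma pi0_eq_zero_of_upTri_of_isNilpotent {x : Mn n} (hx : x ∈ upTri n) (hnil : IsNilpotent x) :
    pi0 x = 0 := by
  obtain ⟨k, hk⟩ := hnil
  have hdiag : ∀ i, x i i = 0 := fun i => by
    have := (upTri_pow_diag hx k).2 i
    rw [hk, Matrix.zero_apply] at this
    exact eq_zero_of_pow_eq_zero this.symm
  simp [pi0, hdiag]

lemma pi0_transpose (x : Mn n) : pi0 xᵀ = pi0 x := rfl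

lemma isNilpotent_transpose {x : Mn n} (h : IsNilpotent x) : IsNilpotent xᵀ := by
  obtain ⟨k, hk⟩ := h
  exact ⟨k, by rw [← transpose_pow, hk, transpose_zero]⟩

lemma pi0_eq_zero_of_loTri_of_isNilpotent {x : Mn n} (hx : x ∈ loTri n) (hnil : IsNilpotent x) :
    pi0 x = 0 := by
  rw [← pi0_transpose]
  exact pi0_eq_zero_of_upTri_of_isNilpotent (transpose_mem_upTri hx) (isNilpotent_transpose hnil)

lemma isNilpotent_of_upTri {x : Mn n} (hx : x ∈ upTri n) (h0 : ∀ i, x i i = 0) :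
    IsNilpotent x := by
  have h := aeval_self_charpoly x
  rw [charpoly_of_isUpperTriangular x hx] at h
  simp only [h0, map_zero, sub_zero, Finset.prod_const, map_pow, Polynomial.aeval_X] at h
  exact ⟨_, h⟩

lemma isNilpotent_of_loTri {x : Mn n} (hx : x ∈ loTri n) (h0 : ∀ i, x i i = 0) :
    IsNilpotent x :=
  isNilpotent_transpose (isNilpotent_of_upTri (transpose_mem_upTri hx) h0)

lemma isNilpotent_AdM {g : Mn n} (hg : IsUnit g.det) {x : Mn n} (h : IsNilpotent x) :
    IsNilpotent (AdM g x) := by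
  obtain ⟨k, hk⟩ := h
  have hpow : ∀ m : ℕ, AdM g x ^ m = AdM g (x ^ m) := by
    intro m
    induction m with
    | zero => simp [AdM_apply, mul_nonsing_inv g hg]
    | succ m ih =>
      rw [pow_succ, ih, pow_succ]
      simp only [AdM_apply]
      linear_combination (norm := noncomm_ring)
        g * x ^ m * (nonsing_inv_mul g hg) * x * g⁻¹
  exact ⟨k, by rw [hpow, hk, map_zero]⟩

lemma trace_pi0 (x : Mn n) : (pi0 x).trace = x.trace := by
  simp [pi0, Matrix.trace]

lemma pi0_mem_upTri (x : Mn n) : pi0 x ∈ upTri n :=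
  fun _ _ hij => diagonal_apply_ne _ hij.ne'

lemma pi0_mem_loTri (x : Mn n) : pi0 x ∈ loTri n :=
  fun _ _ hij => diagonal_apply_ne _ hij.ne

lemma pi0_mem_slSub {x : Mn n} (hx : x ∈ slSub n) : pi0 x ∈ slSub n := by
  have : x.trace = 0 := hx
  rw [slSub, LinearMap.mem_ker, traceLinearMap_apply, trace_pi0, this]

lemma sub_pi0_diag (x : Mn n) (i : Fin n) : (x - pi0 x) i i = 0 := by
  simp [pi0]

variable {h h' : Mn n} {V W U : Submodule ℝ (Mn n)}

/-- On its first direction, `ν*` does not depend on the second one. -/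
lemma nustar_eq_on_left (hh : IsStd h V W) (hh' : IsStd h' V U) (ht : Transv V W) {d : Mn n}
    (hd : d ∈ V) : nustar h d = nustar h' d := by
  obtain ⟨hdet, hV, hW⟩ := hh
  obtain ⟨hdet', hV', -⟩ := hh'
  have hu : IsUnit h.det := by simp [hdet]
  have hu' : IsUnit h'.det := by simp [hdet']
  rw [← hV] at hd
  obtain ⟨x, hx, rfl⟩ := hd
  have hp : pi0 x ∈ bplus n := ⟨pi0_mem_slSub hx.1, pi0_mem_upTri x⟩
  have hp' : pi0 x ∈ bminus n := ⟨pi0_mem_slSub hx.1, pi0_mem_loTri x⟩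
  have hm : x - pi0 x ∈ bplus n := sub_mem hx hp
  have e₁ : nustar h' (AdM h (pi0 x)) = nustar h (AdM h (pi0 x)) := by
    refine nustar_eq_of_mem_inter hu' hu (by rw [hV', hW]; exact ht) ?_ ⟨_, hp', rfl⟩
    rw [hV', ← hV]
    exact ⟨_, hp, rfl⟩
  have hnil := isNilpotent_of_upTri hm.2 (sub_pi0_diag x)
  have e₂ : nustar h' (AdM h (x - pi0 x)) = 0 := by
    have hmem : AdM h (x - pi0 x) ∈ (bplus n).map (AdM h') := by
      rw [hV', ← hV]; exact ⟨_, hm, rfl⟩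
    obtain ⟨z, hz, hzx⟩ := hmem
    rw [← hzx, nustar_AdM hu']
    refine pi0_eq_zero_of_upTri_of_isNilpotent hz.2 ?_
    rw [← AdM_inv_AdM hu' z, hzx]
    exact isNilpotent_AdM (isUnit_nonsing_inv_det h' hu') (isNilpotent_AdM hu hnil)
  have e₃ : nustar h (AdM h (x - pi0 x)) = 0 := by
    rw [nustar_AdM hu, pi0_eq_zero_of_upTri_of_isNilpotent hm.2 hnil]
  simp only [map_sub, sub_eq_zero] at e₂ e₃
  rw [e₂, e₃, e₁]

/-- On its second direction, `ν*` does not depend on the first one. -/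
lemma nustar_eq_on_right (hh : IsStd h V W) (hh' : IsStd h' U W) (ht : Transv V W) {d : Mn n}
    (hd : d ∈ W) : nustar h d = nustar h' d := by
  obtain ⟨hdet, hV, hW⟩ := hh
  obtain ⟨hdet', -, hW'⟩ := hh'
  have hu : IsUnit h.det := by simp [hdet]
  have hu' : IsUnit h'.det := by simp [hdet']
  rw [← hW] at hd
  obtain ⟨x, hx, rfl⟩ := hd
  have hp : pi0 x ∈ bplus n := ⟨pi0_mem_slSub hx.1, pi0_mem_upTri x⟩
  have hp' : pi0 x ∈ bminus n := ⟨pi0_mem_slSub hx.1, pi0_mem_loTri x⟩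
  have hm : x - pi0 x ∈ bminus n := sub_mem hx hp'
  have e₁ : nustar h (AdM h (pi0 x)) = nustar h' (AdM h (pi0 x)) := by
    refine nustar_eq_of_mem_inter hu hu' (by rw [hV, hW']; exact ht) ⟨_, hp, rfl⟩ ?_
    rw [hW', ← hW]
    exact ⟨_, hp', rfl⟩
  have hnil := isNilpotent_of_loTri hm.2 (sub_pi0_diag x)
  have e₂ : nustar h' (AdM h (x - pi0 x)) = 0 := by
    have hmem : AdM h (x - pi0 x) ∈ (bminus n).map (AdM h') := by
      rw [hW', ← hW]; exact ⟨_, hm, rfl⟩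
    obtain ⟨z, hz, hzx⟩ := hmem
    rw [← hzx, nustar_AdM hu']
    refine pi0_eq_zero_of_loTri_of_isNilpotent hz.2 ?_
    rw [← AdM_inv_AdM hu' z, hzx]
    exact isNilpotent_AdM (isUnit_nonsing_inv_det h' hu') (isNilpotent_AdM hu hnil)
  have e₃ : nustar h (AdM h (x - pi0 x)) = 0 := by
    rw [nustar_AdM hu, pi0_eq_zero_of_loTri_of_isNilpotent hm.2 hnil]
  simp only [map_sub, sub_eq_zero] at e₂ e₃
  rw [e₂, e₃, e₁]

/-- `ν*` does not depend on the choice of standardizer. -/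
lemma nustar_eq_of_isStd (hh : IsStd h V W) (hh' : IsStd h' V W) (ht : Transv V W) {d : Mn n}
    (hd : d ∈ slSub n) : nustar h d = nustar h' d := by
  rw [← ht, Submodule.mem_sup] at hd
  obtain ⟨v, hv, w, hw, rfl⟩ := hd
  rw [map_add, map_add, nustar_eq_on_left hh hh' ht hv, nustar_eq_on_right hh hh' ht hw]

/-- `ν*_{i,j}` and `ν*_{k,l}` agree on `V_i ∩ V_l`. -/
lemma nustar_eq_on_inter {V' W' : Submodule ℝ (Mn n)} (hh : IsStd h V W) (hh' : IsStd h' V' W')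
    (ht : Transv V W') {d : Mn n} (hd : d ∈ V) (hd' : d ∈ W') : nustar h d = nustar h' d := by
  obtain ⟨hdet, rfl, -⟩ := hh
  obtain ⟨hdet', -, rfl⟩ := hh'
  exact nustar_eq_of_mem_inter (by simp [hdet]) (by simp [hdet']) ht hd hd'

lemma IsAffPara.sub_mem {A : Set (Mn n)} (hA : IsAffPara A V) {X Y : Mn n} (hX : X ∈ A)
    (hY : Y ∈ A) : X - Y ∈ V := by
  obtain ⟨-, P, -, rfl⟩ := hA
  have := V.sub_mem hX hY
  rwa [sub_sub_sub_cancel_right] at this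

lemma IsAffPara.mem_slSub {A : Set (Mn n)} (hA : IsAffPara A V) (hV : V ≤ slSub n) {X : Mn n}
    (hX : X ∈ A) : X ∈ slSub n := by
  obtain ⟨-, P, hP, rfl⟩ := hA
  have := (slSub n).add_mem (hV hX) hP
  rwa [sub_add_cancel] at this

end Nustar

/-- Let A₁, A₂, A₃, A₄ and A₊ (playing the role of A_*) be five pairwise
transverse affine parabolic spaces. Then the cocycle identity
β(A₁,A_*,A₃,A₄) + β(A_*,A₂,A₃,A₄) = β(A₁,A₂,A₃,A₄) holds. -/
theorem affine_cross_ratio_cocycle (n : ℕ) (hn : 2 ≤ n)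
    (A₁ A₂ A₃ A₄ As : Set (Mn n)) (V₁ V₂ V₃ V₄ Vs : Submodule ℝ (Mn n))
    (h₁ : IsAffPara A₁ V₁) (h₂ : IsAffPara A₂ V₂)
    (h₃ : IsAffPara A₃ V₃) (h₄ : IsAffPara A₄ V₄) (hs : IsAffPara As Vs)
    (t₁₂ : Transv V₁ V₂) (t₁₃ : Transv V₁ V₃) (t₁₄ : Transv V₁ V₄)
    (t₂₃ : Transv V₂ V₃) (t₂₄ : Transv V₂ V₄) (t₃₄ : Transv V₃ V₄)
    (ts₁ : Transv Vs V₁) (ts₂ : Transv Vs V₂) (ts₃ : Transv Vs V₃) (ts₄ : Transv Vs V₄) :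
    ∀ b₁ b₂ b₃ : Mn n,
      IsCross b₁ A₁ As A₃ A₄ V₁ Vs V₃ V₄ →
      IsCross b₂ As A₂ A₃ A₄ Vs V₂ V₃ V₄ →
      IsCross b₃ A₁ A₂ A₃ A₄ V₁ V₂ V₃ V₄ →
      b₁ + b₂ = b₃ := by
  rintro b₁ b₂ b₃ ⟨h14, hs3, X13, Xs4, s14, ss3, ⟨m1, m3⟩, ⟨ms, m4⟩, rfl⟩
    ⟨hs4, h23, Xs3, X24, ss4, s23, ⟨ms', m3'⟩, ⟨m2, m4'⟩, rfl⟩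
    ⟨k14, k23, Y13, Y24, r14, r23, ⟨l1, l3⟩, ⟨l2, l4⟩, rfl⟩
  have le₁ : V₁ ≤ slSub n := t₁₂ ▸ le_sup_left
  have le₂ : V₂ ≤ slSub n := t₁₂ ▸ le_sup_right
  have leₛ : Vs ≤ slSub n := ts₁ ▸ le_sup_left
  rw [nustar_eq_of_isStd s14 r14 t₁₄
      (sub_mem (h₁.mem_slSub le₁ m1) (hs.mem_slSub leₛ ms)),
    nustar_eq_of_isStd s23 r23 t₂₃
      (sub_mem (hs.mem_slSub leₛ ms') (h₂.mem_slSub le₂ m2))]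
  have e₁ := nustar_eq_on_inter r14 r23 t₁₃ (h₁.sub_mem m1 l1) (h₃.sub_mem m3 l3)
  have e₂ := nustar_eq_on_inter r23 r14 t₂₄ (h₂.sub_mem m2 l2) (h₄.sub_mem m4' l4)
  have e₃ := nustar_eq_on_right r14 ss4 t₁₄ (h₄.sub_mem m4' m4)
  have e₄ := nustar_eq_on_right r23 ss3 t₂₃ (h₃.sub_mem m3 m3')
  have e₅ := nustar_eq_on_left ss4 ss3 ts₄ (hs.sub_mem ms' ms)
  simp only [map_sub] at e₁ e₂ e₃ e₄ e₅ ⊢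
  linear_combination (norm := module) e₁ + e₂ + e₃ + e₄ + e₅

end
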